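/- There exists a nonzero polynomial function P on the 35-dimensional space of cubic forms in five variables over ℂ such that, for every cubic form F with P(F) ≠ 0, F defines a smooth cubic threefold V = V(F) ⊂ ℙ⁴ containing no line l with the following property: there exist two distinct lines r₁ ≠ r₂ on V and 2-planes π₁, π₂ with V·πᵢ = l + 2rᵢ for i = 1, 2 and such that the 1-dimensional subspaces l ∩ r₁ and l ∩ r₂ of ℂ⁵ coincide. (Equivalently: for a general smooth cubic threefold, no line l ∈ Γ has two preimages r₁, r₂ ∈ Γ′ meeting l at the same point.) -/

import Mathlib

open MvPolynomial

noncomputable section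

/-- `F` defines a smooth cubic threefold: the only common zero of the five partial
derivatives of `F` is the origin. -/
def IsSmoothCubic (F : MvPolynomial (Fin 5) ℂ) : Prop :=
  ∀ p : Fin 5 → ℂ, (∀ i : Fin 5, eval p (pderiv i F) = 0) → p = 0

/-- A line of `ℙ⁴`: a 2-dimensional linear subspace of `ℂ⁵`. -/
def IsLine (W : Submodule ℂ (Fin 5 → ℂ)) : Prop := Module.finrank ℂ W = 2

/-- A 2-plane of `ℙ⁴`: a 3-dimensional linear subspace of `ℂ⁵`. -/
def IsPlane (W : Submodule ℂ (Fin 5 → ℂ)) : Prop := Module.finrank ℂ W = 3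

/-- The linear subspace `W` lies on the hypersurface defined by `F`. -/
def LiesOn (F : MvPolynomial (Fin 5) ℂ) (W : Submodule ℂ (Fin 5 → ℂ)) : Prop :=
  ∀ p ∈ W, eval p F = 0

/-- The intersection cycle `V(F)·Pl` equals `l + 2r`: the restriction of `F` to the
2-plane `Pl` factors as `c·ℓ·ρ²` where `ℓ`, `ρ` are linear forms, nonzero on `Pl`,
whose kernels cut `l` and `r` respectively out of `Pl`. -/
def CycleLplus2R (F : MvPolynomial (Fin 5) ℂ) (l r Pl : Submodule ℂ (Fin 5 → ℂ)) : Prop :=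
  IsLine l ∧ IsLine r ∧ IsPlane Pl ∧ l ≤ Pl ∧ r ≤ Pl ∧ r ≠ l ∧
  ∃ (c : ℂ) (L R : (Fin 5 → ℂ) →ₗ[ℂ] ℂ), c ≠ 0 ∧
    (∃ p ∈ Pl, L p ≠ 0) ∧ (∃ p ∈ Pl, R p ≠ 0) ∧
    Pl ⊓ LinearMap.ker L = l ∧ Pl ⊓ LinearMap.ker R = r ∧
    ∀ p ∈ Pl, eval p F = c * L p * (R p) ^ 2


/-- The index type of the 35 monomials of degree 3 in five variables, so that
`MvPolynomial Deg3Monomials ℂ` is the ring of polynomial functions (in the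
coefficients) on the 35-dimensional space of cubic forms in five variables. -/
def Deg3Monomials : Type := {d : Fin 5 →₀ ℕ // (d.sum fun _ n => n) = 3}

/-- Linear substitution: the pullback of `F` along the linear map with matrix `g`. -/
def linSubst (g : Matrix (Fin 5) (Fin 5) ℂ) (F : MvPolynomial (Fin 5) ℂ) :
    MvPolynomial (Fin 5) ℂ :=
  aeval (fun i => ∑ j, C (g i j) * X j) F

lemma eval_linSubst (g : Matrix (Fin 5) (Fin 5) ℂ) (F : MvPolynomial (Fin 5) ℂ)
    (x : Fin 5 → ℂ) : eval x (linSubst g F) = eval (g.mulVec x) F := by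
  unfold linSubst
  have h : eval x (aeval (fun i => ∑ j, C (g i j) * X j) F) =
      ((aeval x).comp (aeval (fun i => ∑ j, (C (g i j) * X j : MvPolynomial (Fin 5) ℂ)))) F := by
    simp [aeval_eq_eval]
  rw [h, comp_aeval, aeval_eq_eval]
  congr 2
  ext i
  simp [Matrix.mulVec, dotProduct]

lemma linSubst_isHomogeneous (g : Matrix (Fin 5) (Fin 5) ℂ) {F : MvPolynomial (Fin 5) ℂ}
    (hF : F.IsHomogeneous 3) : (linSubst g F).IsHomogeneous 3 := by
  unfold linSubst
  have := hF.aeval (fun i => ∑ j, (C (g i j) * X j : MvPolynomial (Fin 5) ℂ)) (n := 1)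
    (fun i => IsHomogeneous.sum _ _ _ fun j _ => isHomogeneous_C_mul_X _ _)
  simpa using this

instance finite_deg3 : Finite Deg3Monomials :=
  (Finsupp.finite_of_degree_eq (σ := Fin 5) 3).to_subtype

lemma exists_relation {ι τ : Type} [Finite ι] [Finite τ] (h : Nat.card τ < Nat.card ι)
    (f : ι → MvPolynomial τ ℂ) : ∃ P : MvPolynomial ι ℂ, P ≠ 0 ∧ aeval f P = 0 := by
  by_contra! hP
  have hf : AlgebraicIndependent ℂ f := by
    rw [algebraicIndependent_iff]
    intro p hp
    by_contra h0
    exact hP p h0 hp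
  have h1 := hf.cardinalMk_le_trdeg
  rw [MvPolynomial.trdeg_of_isDomain] at h1
  simp only [Cardinal.lift_id] at h1
  rw [← Nat.cast_card, ← Nat.cast_card (α := τ)] at h1
  have : Nat.card ι ≤ Nat.card τ := by exact_mod_cast h1
  omega

lemma eval_eq_sum_deg3 [Fintype Deg3Monomials] {H : MvPolynomial (Fin 5) ℂ}
    (hH : H.IsHomogeneous 3) (x : Fin 5 → ℂ) :
    eval x H = ∑ m : Deg3Monomials, H.coeff m.1 * ∏ i, x i ^ (m.1 i) := by
  classical
  rw [eval_eq']
  symm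
  have hinj : Function.Injective (fun m : Deg3Monomials => m.1) := Subtype.val_injective
  rw [← Finset.sum_image (f := fun m : Fin 5 →₀ ℕ => H.coeff m * ∏ i, x i ^ (m i))
    (g := fun m : Deg3Monomials => m.1) (fun a _ b _ h => hinj h)]
  symm
  apply Finset.sum_subset
  · intro d hd
    rw [mem_support_iff] at hd
    rw [Finset.mem_image]
    refine ⟨⟨d, ?_⟩, Finset.mem_univ _, rfl⟩
    by_contra h
    exact hd (hH.coeff_eq_zero (d := d) h)
  · intro d _ hd
    rw [notMem_support_iff] at hd
    simp [hd]

lemma eval_smul_of_homogeneous {n : ℕ} {H : MvPolynomial (Fin 5) ℂ} (hH : H.IsHomogeneous n)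
    (t : ℂ) (x : Fin 5 → ℂ) : eval (t • x) H = t ^ n * eval x H := by
  rw [eval_eq', eval_eq', Finset.mul_sum]
  refine Finset.sum_congr rfl fun m hm => ?_
  have h := hH.degree_eq_sum_deg_support hm
  rw [← Finsupp.degree_apply, Finsupp.degree_eq_sum] at h
  simp only [Pi.smul_apply, smul_eq_mul, mul_pow, Finset.prod_mul_distrib,
    Finset.prod_pow_eq_pow_sum, ← h]
  ring

lemma eval_adjugate_linSubst (g : Matrix (Fin 5) (Fin 5) ℂ) {F : MvPolynomial (Fin 5) ℂ}
    (hF : F.IsHomogeneous 3) (x : Fin 5 → ℂ) :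
    eval (g.adjugate.mulVec x) (linSubst g F) = g.det ^ 3 * eval x F := by
  rw [eval_linSubst, Matrix.mulVec_mulVec, Matrix.mul_adjugate, Matrix.smul_mulVec,
    Matrix.one_mulVec, eval_smul_of_homogeneous hF]

lemma sum_good {β S : Type} [Fintype S] [Fintype Deg3Monomials]
    (bad : β → Deg3Monomials) (good : S → Deg3Monomials)
    (hgood : Function.Injective good) (hcover : ∀ m, (∃ s, good s = m) ∨ ∃ b, bad b = m)
    (f : Deg3Monomials → ℂ) (hf : ∀ b, f (bad b) = 0) :
    ∑ m, f m = ∑ s, f (good s) := by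
  classical
  rw [← Finset.sum_image (f := f) (g := good) (fun a _ b _ h => hgood h)]
  symm
  apply Finset.sum_subset (Finset.subset_univ _)
  intro m _ hm
  rcases hcover m with ⟨s, rfl⟩ | ⟨b, rfl⟩
  · exact absurd (Finset.mem_image_of_mem _ (Finset.mem_univ s)) hm
  · exact hf b

/-- The generic cubic of the family. -/
def genericCubic {τ S : Type} [Fintype S] (good : S → Deg3Monomials)
    (A : Matrix (Fin 5) (Fin 5) (MvPolynomial τ ℂ)) (c : S → MvPolynomial τ ℂ) :
    MvPolynomial (Fin 5) (MvPolynomial τ ℂ) :=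
  ∑ m : S, C (c m) * ∏ i, (∑ j, C (A i j) * X j) ^ ((good m).1 i)

lemma eval_genericCubic {τ S : Type} [Fintype S] (good : S → Deg3Monomials)
    (A : Matrix (Fin 5) (Fin 5) (MvPolynomial τ ℂ)) (c : S → MvPolynomial τ ℂ)
    (θ : τ → ℂ) (x : Fin 5 → ℂ) :
    eval x (MvPolynomial.map (eval θ) (genericCubic good A c)) =
      ∑ m : S, eval θ (c m) * ∏ i, ((A.map (eval θ)).mulVec x) i ^ ((good m).1 i) := by
  simp only [genericCubic, map_sum, map_mul, map_prod, map_pow, map_C, map_X, eval_C, eval_X]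
  rfl

/-- The dimension count: cubics whose pullback along some member of an algebraic family of
matrices with parameter space `τ` misses more than `card τ` prescribed monomials satisfy a
nontrivial polynomial relation. -/
lemma exists_poly_of_family_aux {τ β S : Type} [Finite τ] [Finite S] (bad : β → Deg3Monomials)
    (good : S → Deg3Monomials)
    (hgood : Function.Injective good) (hcover : ∀ m, (∃ s, good s = m) ∨ ∃ b, bad b = m)
    (hcard : Nat.card (S ⊕ τ) < Nat.card Deg3Monomials)
    (G : Matrix (Fin 5) (Fin 5) (MvPolynomial τ ℂ)) :
    ∃ P : MvPolynomial Deg3Monomials ℂ, P ≠ 0 ∧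
      ∀ F : MvPolynomial (Fin 5) ℂ, F.IsHomogeneous 3 →
        ∀ θ : τ → ℂ, (G.map (eval θ)).det ≠ 0 →
        (∀ b, (linSubst (G.map (eval θ)) F).coeff (bad b).1 = 0) →
        eval (fun d : Deg3Monomials => F.coeff d.1) P = 0 := by
  classical
  let _ : Fintype Deg3Monomials := Fintype.ofFinite _
  let _ : Fintype S := Fintype.ofFinite _
  obtain ⟨A, hAdef⟩ : ∃ A : Matrix (Fin 5) (Fin 5) (MvPolynomial (S ⊕ τ) ℂ),
    A = (G.map (rename (Sum.inr : τ → S ⊕ τ)).toRingHom).adjugate := ⟨_, rfl⟩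
  obtain ⟨Φ, hΦ⟩ : ∃ Φ, Φ = genericCubic good A (fun m => X (Sum.inl m)) := ⟨_, rfl⟩
  obtain ⟨P, hP0, hP⟩ := exists_relation hcard (fun d : Deg3Monomials => Φ.coeff d.1)
  refine ⟨P, hP0, ?_⟩
  intro F hF θ hdet hzero
  obtain ⟨g, hg⟩ : ∃ g, g = G.map (eval θ) := ⟨_, rfl⟩
  rw [← hg] at hdet hzero
  have hH : (linSubst g F).IsHomogeneous 3 := linSubst_isHomogeneous g hF
  obtain ⟨θ', hθ'⟩ : ∃ θ' : S ⊕ τ → ℂ,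
    θ' = Sum.elim (fun m => (linSubst g F).coeff (good m).1 / g.det ^ 3) θ := ⟨_, rfl⟩
  have hA : A.map (eval θ') = g.adjugate := by
    have h1 := RingHom.map_adjugate (eval θ') (G.map (rename (Sum.inr : τ → S ⊕ τ)).toRingHom)
    simp only [RingHom.mapMatrix_apply] at h1
    rw [hAdef, h1]
    congr 1
    ext i j
    simp [hg, eval_rename, hθ', Function.comp_def]
  have hFΦ : F = MvPolynomial.map (eval θ') Φ := by
    apply MvPolynomial.funext
    intro x
    rw [hΦ, eval_genericCubic, hA]
    have h4 := eval_adjugate_linSubst g hF x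
    rw [eval_eq_sum_deg3 hH, sum_good bad good hgood hcover _ (fun b => by simp [hzero b])] at h4
    have h5 : eval x F = (g.det ^ 3 * eval x F) / g.det ^ 3 := by field_simp
    rw [h5, ← h4, Finset.sum_div]
    refine Finset.sum_congr rfl fun m _ => ?_
    simp only [eval_X, hθ', Sum.elim_inl]
    ring
  have h6 : (fun d : Deg3Monomials => F.coeff d.1) =
      fun d : Deg3Monomials => eval θ' (Φ.coeff d.1) := by
    funext d
    rw [hFΦ, coeff_map]
  rw [h6]
  have h7 := congrArg (aeval θ') hP
  rw [map_zero, ← AlgHom.comp_apply, comp_aeval] at h7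
  simpa [aeval_eq_eval] using h7

lemma exists_poly_of_family {τ β : Type} [Finite τ] [Finite β] (bad : β → Deg3Monomials)
    (hbad : Function.Injective bad) (hcard : Nat.card τ < Nat.card β)
    (G : Matrix (Fin 5) (Fin 5) (MvPolynomial τ ℂ)) :
    ∃ P : MvPolynomial Deg3Monomials ℂ, P ≠ 0 ∧
      ∀ F : MvPolynomial (Fin 5) ℂ, F.IsHomogeneous 3 →
        ∀ θ : τ → ℂ, (G.map (eval θ)).det ≠ 0 →
        (∀ b, (linSubst (G.map (eval θ)) F).coeff (bad b).1 = 0) →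
        eval (fun d : Deg3Monomials => F.coeff d.1) P = 0 := by
  classical
  refine exists_poly_of_family_aux (S := {m : Deg3Monomials // ¬ m ∈ Set.range bad}) bad
    Subtype.val Subtype.val_injective ?_ ?_ G
  · intro m
    by_cases h : m ∈ Set.range bad
    · exact Or.inr h
    · exact Or.inl ⟨⟨m, h⟩, rfl⟩
  · have e1 : Nat.card Deg3Monomials = Nat.card {m : Deg3Monomials // m ∈ Set.range bad} +
        Nat.card {m : Deg3Monomials // ¬ m ∈ Set.range bad} := by
      rw [← Nat.card_sum]
      exact Nat.card_congr (Equiv.sumCompl (fun m => m ∈ Set.range bad)).symm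
    have e2 : Nat.card {m : Deg3Monomials // m ∈ Set.range bad} = Nat.card β :=
      (Nat.card_congr (Equiv.ofInjective bad hbad)).symm
    rw [Nat.card_sum]
    omega

lemma coeff_restrict (T : Finset (Fin 5)) (H : MvPolynomial (Fin 5) ℂ) (d : Fin 5 →₀ ℕ)
    (hd : ∀ i, i ∉ T → d i = 0) :
    coeff d (aeval (fun i => if i ∈ T then (X i : MvPolynomial (Fin 5) ℂ) else 0) H) =
      coeff d H := by
  classical
  induction H using MvPolynomial.induction_on' with
  | add p q hp hq => rw [map_add, coeff_add, coeff_add, hp, hq]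
  | monomial u a =>
    rw [aeval_monomial]
    by_cases hu : ∀ i, i ∉ T → u i = 0
    · have : (u.prod fun i k => (if i ∈ T then (X i : MvPolynomial (Fin 5) ℂ) else 0) ^ k) =
          u.prod fun i k => X i ^ k := by
        refine Finsupp.prod_congr fun i hi => ?_
        rw [if_pos]
        by_contra h
        exact (Finsupp.mem_support_iff.1 hi) (hu i h)
      rw [this, monomial_eq]
      rfl
    · push Not at hu
      obtain ⟨i, hi, hui⟩ := hu
      have : (u.prod fun i k => (if i ∈ T then (X i : MvPolynomial (Fin 5) ℂ) else 0) ^ k) = 0 := by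
        refine Finset.prod_eq_zero (i := i) (Finsupp.mem_support_iff.2 hui) ?_
        simp [hi, hui]
      rw [this, mul_zero, coeff_zero, coeff_monomial, if_neg]
      rintro rfl
      exact hui (hd i hi)

lemma coeff_eq_zero_of_eval (T : Finset (Fin 5)) (H : MvPolynomial (Fin 5) ℂ) (k : ℂ)
    (m : Fin 5 →₀ ℕ)
    (h : ∀ x : Fin 5 → ℂ, (∀ i, i ∉ T → x i = 0) → eval x H = k * ∏ i, x i ^ m i)
    (hmT : ∀ i, i ∉ T → m i = 0)
    (d : Fin 5 →₀ ℕ) (hd : ∀ i, i ∉ T → d i = 0) (hdm : d ≠ m) : coeff d H = 0 := by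
  classical
  rw [← coeff_restrict T H d hd]
  have : aeval (fun i => if i ∈ T then (X i : MvPolynomial (Fin 5) ℂ) else 0) H =
      monomial m k := by
    apply MvPolynomial.funext
    intro x
    have h1 : eval x (aeval (fun i => if i ∈ T then (X i : MvPolynomial (Fin 5) ℂ) else 0) H) =
        eval (fun i => if i ∈ T then x i else 0) H := by
      have : eval x (aeval (fun i => if i ∈ T then (X i : MvPolynomial (Fin 5) ℂ) else 0) H) =
        ((aeval x).comp (aeval (fun i => if i ∈ T then (X i : MvPolynomial (Fin 5) ℂ) else 0))) H := by
        simp [aeval_eq_eval]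
      rw [this, comp_aeval, aeval_eq_eval]
      congr 2
      ext i
      split_ifs <;> simp
    rw [h1, h _ (by intro i hi; simp [hi]), eval_monomial,
      Finsupp.prod_fintype _ _ (by simp)]
    congr 1
    refine Finset.prod_congr rfl fun i _ => ?_
    by_cases hi : i ∈ T
    · simp [hi]
    · simp [hmT i hi]
  rw [this, coeff_monomial, if_neg (Ne.symm hdm)]

lemma pderiv_linSubst (g : Matrix (Fin 5) (Fin 5) ℂ) (k : Fin 5) (F : MvPolynomial (Fin 5) ℂ) :
    pderiv k (linSubst g F) = ∑ r, C (g r k) * linSubst g (pderiv r F) := by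
  unfold linSubst
  induction F using MvPolynomial.induction_on with
  | C a => simp
  | add p q hp hq =>
    simp only [map_add, hp, hq, mul_add, Finset.sum_add_distrib]
  | mul_X p i hp =>
    simp only [map_mul, aeval_X, Derivation.leibniz, smul_eq_mul, hp, pderiv_X, map_add, map_sum,
      pderiv_C, mul_zero, add_zero, mul_add, Finset.sum_add_distrib]
    congr 1
    · simp [Pi.single_apply, Finset.sum_ite_eq, mul_comm, apply_ite]
    · rw [Finset.mul_sum]
      refine Finset.sum_congr rfl fun r _ => by ring

lemma smooth_chart (i0 : Fin 5) : ∃ P : MvPolynomial Deg3Monomials ℂ, P ≠ 0 ∧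
      ∀ F : MvPolynomial (Fin 5) ℂ, F.IsHomogeneous 3 →
        ∀ p : Fin 5 → ℂ, p i0 = 1 → (∀ i : Fin 5, eval p (pderiv i F) = 0) →
        eval (fun d : Deg3Monomials => F.coeff d.1) P = 0 := by
  let bad : Fin 5 → Deg3Monomials := fun k =>
    ⟨Finsupp.single i0 2 + Finsupp.single k 1, by
      change Finsupp.degree _ = 3
      simp⟩
  have hbad : Function.Injective bad := by
    intro a b h
    have h := congrArg Subtype.val h
    simp only [bad, add_right_inj] at h
    exact (Finsupp.single_left_inj one_ne_zero).1 h
  obtain ⟨P, hP0, hP⟩ := exists_poly_of_family (τ := Fin 4) bad hbad (by simp)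
    ((1 : Matrix (Fin 5) (Fin 5) _).updateCol i0 (Fin.insertNth i0 1 (fun i : Fin 4 => X i)))
  refine ⟨P, hP0, fun F hF p hp hs => hP F hF (fun i => p (i0.succAbove i)) ?_ ?_⟩
  all_goals
    have hG : (((1 : Matrix (Fin 5) (Fin 5) (MvPolynomial (Fin 4) ℂ)).updateCol i0
        (Fin.insertNth i0 1 (fun i : Fin 4 => X i))).map
        (eval (fun i => p (i0.succAbove i)))) =
        (1 : Matrix (Fin 5) (Fin 5) ℂ).updateCol i0 p := by
      ext a b
      rw [Matrix.map_apply, Matrix.updateCol_apply, Matrix.updateCol_apply]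
      split_ifs with hb
      · refine Fin.succAboveCases i0 ?_ ?_ a
        · rw [Fin.insertNth_apply_same, map_one, hp]
        · intro j; rw [Fin.insertNth_apply_succAbove, eval_X]
      · by_cases hab : a = b
        · rw [hab, Matrix.one_apply_eq, Matrix.one_apply_eq, map_one]
        · rw [Matrix.one_apply_ne hab, Matrix.one_apply_ne hab, map_zero]
    rw [hG]
  · rw [← Matrix.cramer_apply, Matrix.cramer_one]
    simp [hp]
  · intro k
    set g := (1 : Matrix (Fin 5) (Fin 5) ℂ).updateCol i0 p
    have hgp : g.mulVec (Pi.single i0 1) = p := by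
      ext a
      simp [g]
    have h1 : eval (Pi.single i0 1) (pderiv k (linSubst g F)) = 0 := by
      rw [pderiv_linSubst]
      simp [eval_linSubst, hgp, hs]
    have hH := (linSubst_isHomogeneous g hF).pderiv (i := k)
    have h2 : coeff (Finsupp.single i0 2) (pderiv k (linSubst g F)) = 0 := by
      refine coeff_eq_zero_of_eval {i0} _ 0 0 ?_ (by simp) _ ?_ (by simp)
      · intro x hx
        have : x = x i0 • (Pi.single i0 1 : Fin 5 → ℂ) := by
          ext i
          by_cases hi : i = i0
          · subst hi; simp
          · simp [hi, hx i (by simpa using hi)]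
        rw [this, eval_smul_of_homogeneous hH, h1]
        simp
      · intro i hi
        have : i ≠ i0 := by simpa using hi
        simp [this]
    rw [coeff_pderiv] at h2
    rcases mul_eq_zero.1 h2 with h | h
    · exact h
    · exact absurd h (Nat.cast_add_one_ne_zero _)

/-- The exponents of the monomials that must vanish, as functions. -/
def badFun : Fin 14 → Fin 5 → ℕ :=
  ![![3,0,0,0,0], ![2,1,0,0,0], ![1,2,0,0,0], ![0,3,0,0,0],
    ![2,0,1,0,0], ![1,1,1,0,0], ![1,0,2,0,0], ![0,1,2,0,0], ![0,0,3,0,0],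
    ![2,0,0,1,0], ![1,1,0,1,0], ![1,0,0,2,0], ![0,1,0,2,0], ![0,0,0,3,0]]

/-- The monomials that must vanish. -/
def badMon (b : Fin 14) : Deg3Monomials :=
  ⟨Finsupp.equivFunOnFinite.symm (badFun b), by
    rw [Finsupp.sum_fintype _ _ (by simp)]
    simp only [Finsupp.equivFunOnFinite_symm_apply_apply]
    revert b
    decide⟩

lemma badMon_apply (b : Fin 14) (i : Fin 5) : (badMon b).1 i = badFun b i := rfl

lemma badMon_injective : Function.Injective badMon := by
  intro a b h
  have h1 : badFun a = badFun b := by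
    funext i
    rw [← badMon_apply, h, badMon_apply]
  revert a b
  have : Function.Injective badFun := by decide
  exact fun a b _ h => this h

lemma bad_coeff_zero (H : MvPolynomial (Fin 5) ℂ) (k₁ k₂ : ℂ)
    (h₁ : ∀ a b c : ℂ, eval ![a, b, c, 0, 0] H = k₁ * (b ^ 2 * c))
    (h₂ : ∀ a b c : ℂ, eval ![a, b, 0, c, 0] H = k₂ * (b ^ 2 * c)) (b : Fin 14) :
    coeff (badMon b).1 H = 0 := by
  by_cases hb : ∀ i, i ∉ ({0, 1, 2} : Finset (Fin 5)) → badFun b i = 0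
  · refine coeff_eq_zero_of_eval {0, 1, 2} H k₁ (Finsupp.equivFunOnFinite.symm ![0,2,1,0,0])
      ?_ ?_ _ hb ?_
    · intro x hx
      have : x = ![x 0, x 1, x 2, 0, 0] := by
        ext i
        fin_cases i <;> simp [hx 3 (by decide), hx 4 (by decide)]
      rw [this, h₁]
      simp [Fin.prod_univ_five]
    · simp only [Finsupp.equivFunOnFinite_symm_apply_apply]
      decide
    · intro h
      have : badFun b = ![0,2,1,0,0] := by
        funext i
        rw [← badMon_apply, h]
        rfl
      revert this
      clear hb h
      revert b
      decide
  · have hb : ∀ i, i ∉ ({0, 1, 3} : Finset (Fin 5)) → badFun b i = 0 := by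
      revert b
      decide
    refine coeff_eq_zero_of_eval {0, 1, 3} H k₂ (Finsupp.equivFunOnFinite.symm ![0,2,0,1,0])
      ?_ ?_ _ hb ?_
    · intro x hx
      have : x = ![x 0, x 1, 0, x 3, 0] := by
        ext i
        fin_cases i <;> simp [hx 2 (by decide), hx 4 (by decide)]
      rw [this, h₂]
      simp [Fin.prod_univ_five]
    · simp only [Finsupp.equivFunOnFinite_symm_apply_apply]
      decide
    · intro h
      have : badFun b = ![0,2,0,1,0] := by
        funext i
        rw [← badMon_apply, h]
        rfl
      revert this
      clear hb h
      revert b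
      decide

/-- The matrix of the chart. -/
def chartMat (i0 : Fin 5) (s : Fin 3 → Fin 4) (j : Fin 5) :
    Matrix (Fin 5) (Fin 5) (MvPolynomial (Fin 4 ⊕ Fin 3 × Fin 3) ℂ) :=
  Matrix.of fun r c =>
    (![Fin.insertNth i0 1 (fun a : Fin 4 => X (Sum.inl a)),
      Fin.insertNth i0 0 (Fin.insertNth (s 0) 1 (fun a : Fin 3 => X (Sum.inr (0, a)))),
      Fin.insertNth i0 0 (Fin.insertNth (s 1) 1 (fun a : Fin 3 => X (Sum.inr (1, a)))),
      Fin.insertNth i0 0 (Fin.insertNth (s 2) 1 (fun a : Fin 3 => X (Sum.inr (2, a)))),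
      Pi.single j 1] : Fin 5 → Fin 5 → MvPolynomial (Fin 4 ⊕ Fin 3 × Fin 3) ℂ) c r

lemma insertNth_eval {τ : Type} {n : ℕ} (θ : τ → ℂ) (i : Fin (n + 1)) (a : MvPolynomial τ ℂ)
    (f : Fin n → MvPolynomial τ ℂ) (r : Fin (n + 1)) :
    eval θ ((Fin.insertNth i a f : Fin (n + 1) → MvPolynomial τ ℂ) r) =
      (Fin.insertNth i (eval θ a) (fun k => eval θ (f k)) : Fin (n + 1) → ℂ) r := by
  refine Fin.succAboveCases i ?_ ?_ r
  · rw [Fin.insertNth_apply_same, Fin.insertNth_apply_same]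
  · intro k
    rw [Fin.insertNth_apply_succAbove, Fin.insertNth_apply_succAbove]

lemma insertNth_one_eq (i : Fin 5) (v : Fin 5 → ℂ) (c : ℂ) (h : v i = c) :
    (Fin.insertNth i c (fun k => v (i.succAbove k)) : Fin 5 → ℂ) = v := by
  rw [Fin.insertNth_eq_iff]
  exact ⟨h.symm, rfl⟩

lemma insertNth_one_eq' (i : Fin 4) (v : Fin 4 → ℂ) (c : ℂ) (h : v i = c) :
    (Fin.insertNth i c (fun k => v (i.succAbove k)) : Fin 4 → ℂ) = v := by
  rw [Fin.insertNth_eq_iff]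
  exact ⟨h.symm, rfl⟩

lemma exists_chart_param (i0 : Fin 5) (s : Fin 3 → Fin 4) (j : Fin 5) (e0 e1 e2 e3 : Fin 5 → ℂ)
    (h0 : e0 i0 = 1) (h1 : e1 i0 = 0) (h2 : e2 i0 = 0) (h3 : e3 i0 = 0)
    (k1 : e1 (i0.succAbove (s 0)) = 1) (k2 : e2 (i0.succAbove (s 1)) = 1)
    (k3 : e3 (i0.succAbove (s 2)) = 1) :
    ∃ θ, (chartMat i0 s j).map (eval θ) =
      Matrix.of fun r c => (![e0, e1, e2, e3, Pi.single j 1] : Fin 5 → Fin 5 → ℂ) c r := by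
  refine ⟨Sum.elim (fun a => e0 (i0.succAbove a)) (fun q =>
    (![e1, e2, e3] : Fin 3 → Fin 5 → ℂ) q.1 (i0.succAbove ((s q.1).succAbove q.2))), ?_⟩
  ext r c
  rw [Matrix.map_apply, chartMat, Matrix.of_apply, Matrix.of_apply]
  fin_cases c
  · simp only [Fin.zero_eta, Matrix.cons_val_zero]
    rw [insertNth_eval]
    simp only [map_one, eval_X, Sum.elim_inl]
    rw [insertNth_one_eq _ _ _ h0]
  · simp only [Fin.mk_one, Matrix.cons_val_one, Matrix.cons_val_zero]
    rw [insertNth_eval]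
    simp only [map_zero, insertNth_eval, map_one, eval_X, Sum.elim_inr, Matrix.cons_val_zero]
    rw [insertNth_one_eq' _ (fun k => e1 (i0.succAbove k)) _ k1, insertNth_one_eq _ _ _ h1]
  · simp only [Fin.reduceFinMk, Matrix.cons_val]
    rw [insertNth_eval]
    simp only [map_zero, insertNth_eval, map_one, eval_X, Sum.elim_inr, Matrix.cons_val_one,
      Matrix.cons_val_zero]
    rw [insertNth_one_eq' _ (fun k => e2 (i0.succAbove k)) _ k2, insertNth_one_eq _ _ _ h2]
  · simp only [Fin.reduceFinMk, Matrix.cons_val]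
    rw [insertNth_eval]
    simp only [map_zero, insertNth_eval, map_one, eval_X, Sum.elim_inr, Matrix.cons_val]
    rw [insertNth_one_eq' _ (fun k => e3 (i0.succAbove k)) _ k3, insertNth_one_eq _ _ _ h3]
  · simp only [Fin.reduceFinMk, Matrix.cons_val, Pi.single_apply]
    split_ifs <;> simp

lemma normalize_vector {W U : Submodule ℂ (Fin 5 → ℂ)} {i0 : Fin 5} {e0 e : Fin 5 → ℂ}
    (h0W : e0 ∈ W) (h0U : e0 ∈ U) (h0 : e0 i0 = 1) (heW : e ∈ W) (heU : e ∉ U) :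
    ∃ (e' : Fin 5 → ℂ) (t : Fin 4), e' ∈ W ∧ e' ∉ U ∧ e' i0 = 0 ∧ e' (i0.succAbove t) = 1 := by
  set f := e - e i0 • e0 with hf
  have hfW : f ∈ W := W.sub_mem heW (W.smul_mem _ h0W)
  have hfU : f ∉ U := by
    intro h
    apply heU
    have := U.add_mem h (U.smul_mem (e i0) h0U)
    simpa [hf] using this
  have hf0 : f i0 = 0 := by simp [hf, h0]
  obtain ⟨t, ht⟩ : ∃ t : Fin 4, f (i0.succAbove t) ≠ 0 := by
    by_contra! h
    apply hfU
    have : f = 0 := by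
      funext r
      refine Fin.succAboveCases i0 ?_ ?_ r
      · exact hf0
      · exact h
    rw [this]
    exact U.zero_mem
  refine ⟨(f (i0.succAbove t))⁻¹ • f, t, W.smul_mem _ hfW, ?_, by simp [hf0], by simp [ht]⟩
  intro h
  apply hfU
  have := U.smul_mem (f (i0.succAbove t)) h
  rwa [smul_smul, mul_inv_cancel₀ ht, one_smul] at this

lemma exists_std_completion (e : Fin 4 → Fin 5 → ℂ) (he : LinearIndependent ℂ e) :
    ∃ j : Fin 5, (Matrix.of fun r c =>
      (![e 0, e 1, e 2, e 3, Pi.single j 1] : Fin 5 → Fin 5 → ℂ) c r).det ≠ 0 := by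
  obtain ⟨j, hj⟩ : ∃ j : Fin 5, (Pi.single j 1 : Fin 5 → ℂ) ∉ Submodule.span ℂ (Set.range e) := by
    by_contra! h
    have htop : Submodule.span ℂ (Set.range e) = ⊤ := by
      rw [eq_top_iff, ← (Pi.basisFun ℂ (Fin 5)).span_eq, Submodule.span_le]
      rintro _ ⟨j, rfl⟩
      simpa using h j
    have h1 := finrank_span_eq_card he
    rw [htop, finrank_top] at h1
    simp at h1
  refine ⟨j, ?_⟩
  have hli : LinearIndependent ℂ (Fin.snoc e (Pi.single j 1 : Fin 5 → ℂ) : Fin 5 → Fin 5 → ℂ) :=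
    linearIndependent_finSnoc.2 ⟨he, hj⟩
  have heq : (Matrix.of fun r c =>
      (![e 0, e 1, e 2, e 3, Pi.single j 1] : Fin 5 → Fin 5 → ℂ) c r).col =
      (Fin.snoc e (Pi.single j 1 : Fin 5 → ℂ) : Fin 5 → Fin 5 → ℂ) := by
    funext c
    fin_cases c <;> rfl
  rw [← heq, Matrix.linearIndependent_cols_iff_isUnit, Matrix.isUnit_iff_isUnit_det] at hli
  exact hli.ne_zero

lemma cycle_eval {F : MvPolynomial (Fin 5) ℂ} {l r Pl : Submodule ℂ (Fin 5 → ℂ)}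
    (h : CycleLplus2R F l r Pl) {e0 e1 e2 : Fin 5 → ℂ} (h0l : e0 ∈ l) (h0r : e0 ∈ r)
    (h1 : e1 ∈ l) (h2 : e2 ∈ r) :
    ∃ k : ℂ, ∀ a b c : ℂ, eval (a • e0 + b • e1 + c • e2) F = k * (b ^ 2 * c) := by
  obtain ⟨-, -, -, hlP, hrP, -, c, L, R, -, -, -, hL, hR, hF⟩ := h
  have L0 : L e0 = 0 := by rw [← hL] at h0l; exact h0l.2
  have L1 : L e1 = 0 := by rw [← hL] at h1; exact h1.2
  have R0 : R e0 = 0 := by rw [← hR] at h0r; exact h0r.2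
  have R2 : R e2 = 0 := by rw [← hR] at h2; exact h2.2
  refine ⟨c * L e2 * R e1 ^ 2, fun a b d => ?_⟩
  rw [hF _ (Pl.add_mem (Pl.add_mem (Pl.smul_mem _ (hlP h0l)) (Pl.smul_mem _ (hlP h1)))
    (Pl.smul_mem _ (hrP h2)))]
  simp only [map_add, map_smul, L0, L1, R0, R2, smul_eq_mul]
  ring

lemma line_chart (q : Fin 5 × (Fin 3 → Fin 4) × Fin 5) :
    ∃ P : MvPolynomial Deg3Monomials ℂ, P ≠ 0 ∧
      ∀ F : MvPolynomial (Fin 5) ℂ, F.IsHomogeneous 3 →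
        ∀ θ, ((chartMat q.1 q.2.1 q.2.2).map (eval θ)).det ≠ 0 →
        (∀ b, (linSubst ((chartMat q.1 q.2.1 q.2.2).map (eval θ)) F).coeff (badMon b).1 = 0) →
        eval (fun d : Deg3Monomials => F.coeff d.1) P = 0 :=
  exists_poly_of_family badMon badMon_injective (by simp) _

/-- The geometric part: a bad configuration gives a normalized frame. -/
lemma exists_frame {F : MvPolynomial (Fin 5) ℂ} {l r₁ r₂ Pl₁ Pl₂ : Submodule ℂ (Fin 5 → ℂ)}
    (hr : r₁ ≠ r₂) (hF2 : LiesOn F r₂) (hc1 : CycleLplus2R F l r₁ Pl₁)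
    (hc2 : CycleLplus2R F l r₂ Pl₂) (hd : Module.finrank ℂ ↥(l ⊓ r₁) = 1)
    (heq : l ⊓ r₁ = l ⊓ r₂) :
    ∃ (i0 : Fin 5) (s : Fin 3 → Fin 4) (e : Fin 4 → Fin 5 → ℂ), LinearIndependent ℂ e ∧
      e 0 i0 = 1 ∧ e 1 i0 = 0 ∧ e 2 i0 = 0 ∧ e 3 i0 = 0 ∧
      e 1 (i0.succAbove (s 0)) = 1 ∧ e 2 (i0.succAbove (s 1)) = 1 ∧
      e 3 (i0.succAbove (s 2)) = 1 ∧
      e 0 ∈ l ∧ e 0 ∈ r₁ ∧ e 0 ∈ r₂ ∧ e 1 ∈ l ∧ e 2 ∈ r₁ ∧ e 3 ∈ r₂ := by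
  have hl : Module.finrank ℂ l = 2 := hc1.1
  have hr1 : Module.finrank ℂ r₁ = 2 := hc1.2.1
  have hr2 : Module.finrank ℂ r₂ = 2 := hc2.2.1
  have key : ∀ {W U : Submodule ℂ (Fin 5 → ℂ)}, Module.finrank ℂ W = 2 →
      Module.finrank ℂ ↥(W ⊓ U) = 1 → ∃ e ∈ W, e ∉ U := by
    intro W U h2 h1
    by_contra! h
    have : W ⊓ U = W := inf_eq_left.2 h
    rw [this] at h1
    omega
  have hd1 : Module.finrank ℂ ↥(r₁ ⊓ l) = 1 := by rwa [inf_comm]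
  have hd2 : Module.finrank ℂ ↥(r₂ ⊓ l) = 1 := by rwa [inf_comm, ← heq]
  obtain ⟨v, hv0, -⟩ := finrank_eq_one_iff'.1 hd
  have hv0' : (v : Fin 5 → ℂ) ≠ 0 := by simpa using hv0
  obtain ⟨i0, hi0⟩ := Function.ne_iff.1 hv0'
  simp only [Pi.zero_apply] at hi0
  set e0 : Fin 5 → ℂ := ((v : Fin 5 → ℂ) i0)⁻¹ • (v : Fin 5 → ℂ) with he0
  have h0m : e0 ∈ l ⊓ r₁ := Submodule.smul_mem _ _ v.2
  have h0l : e0 ∈ l := h0m.1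
  have h0r1 : e0 ∈ r₁ := h0m.2
  have h0r2 : e0 ∈ r₂ := by rw [heq] at h0m; exact h0m.2
  have h0 : e0 i0 = 1 := by simp [he0, hi0]
  obtain ⟨f1, hf1, hf1'⟩ := key hl hd
  obtain ⟨f2, hf2, hf2'⟩ := key hr1 hd1
  obtain ⟨f3, hf3, hf3'⟩ := key hr2 hd2
  obtain ⟨e1, s1, h1l, h1r, h10, h1s⟩ := normalize_vector h0l h0r1 h0 hf1 hf1'
  obtain ⟨e2, s2, h2r, h2l, h20, h2s⟩ := normalize_vector h0r1 h0l h0 hf2 hf2'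
  obtain ⟨e3, s3, h3r, h3l, h30, h3s⟩ := normalize_vector h0r2 h0l h0 hf3 hf3'
  have e0ne : e0 ≠ 0 := by
    intro h
    rw [h] at h0
    simp at h0
  obtain ⟨-, -, -, hlP, hrP, -, c, L, R, hc, -, -, hL, hR, hF⟩ := hc1
  -- the last vector is not in the first plane
  have h3P : e3 ∉ Pl₁ := by
    intro h
    have hz := hF e3 h
    rw [hF2 e3 h3r] at hz
    have hL3 : L e3 ≠ 0 := by
      intro h'
      apply h3l
      rw [← hL]
      exact ⟨h, h'⟩
    have hR3 : R e3 = 0 := by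
      have := hz.symm
      simpa [hc, hL3] using this
    have h3r1 : e3 ∈ r₁ := by
      rw [← hR]
      exact ⟨h, hR3⟩
    have hli : LinearIndependent ℂ ![e0, e3] := by
      rw [LinearIndependent.pair_iff' e0ne]
      rintro a rfl
      exact h3l (l.smul_mem _ h0l)
    have hsp := finrank_span_eq_card hli
    have aux : ∀ W : Submodule ℂ (Fin 5 → ℂ), Module.finrank ℂ W = 2 → e0 ∈ W → e3 ∈ W →
        Submodule.span ℂ (Set.range ![e0, e3]) = W := by
      intro W hW ha hb
      apply Submodule.eq_of_le_of_finrank_eq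
      · rw [Submodule.span_le]
        rintro _ ⟨i, rfl⟩
        fin_cases i
        · exact ha
        · exact hb
      · rw [hsp, hW]; rfl
    exact hr ((aux r₁ hr1 h0r1 h3r1).symm.trans (aux r₂ hr2 h0r2 h3r))
  refine ⟨i0, ![s1, s2, s3], ![e0, e1, e2, e3], ?_, h0, h10, h20, h30, h1s, h2s, h3s, h0l, h0r1,
    h0r2, h1l, h2r, h3r⟩
  rw [Fintype.linearIndependent_iff]
  intro a ha
  simp only [Fin.sum_univ_four, Matrix.cons_val_zero, Matrix.cons_val_one, Matrix.cons_val] at ha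
  have a3 : a 3 = 0 := by
    by_contra hne
    apply h3P
    have : a 3 • e3 ∈ Pl₁ := by
      have h' : a 3 • e3 = -(a 0 • e0 + a 1 • e1 + a 2 • e2) := by
        rw [eq_neg_iff_add_eq_zero, add_comm]; exact ha
      rw [h']
      exact Pl₁.neg_mem (Pl₁.add_mem (Pl₁.add_mem (Pl₁.smul_mem _ (hlP h0l))
        (Pl₁.smul_mem _ (hlP h1l))) (Pl₁.smul_mem _ (hrP h2r)))
    exact (Submodule.smul_mem_iff _ hne).1 this
  rw [a3, zero_smul, add_zero] at ha
  have a2 : a 2 = 0 := by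
    by_contra hne
    apply h2l
    have : a 2 • e2 ∈ l := by
      have h' : a 2 • e2 = -(a 0 • e0 + a 1 • e1) := by
        rw [eq_neg_iff_add_eq_zero, add_comm]; exact ha
      rw [h']
      exact l.neg_mem (l.add_mem (l.smul_mem _ h0l) (l.smul_mem _ h1l))
    exact (Submodule.smul_mem_iff _ hne).1 this
  rw [a2, zero_smul, add_zero] at ha
  have a1 : a 1 = 0 := by
    by_contra hne
    apply h1r
    have : a 1 • e1 ∈ r₁ := by
      have h' : a 1 • e1 = -(a 0 • e0) := by
        rw [eq_neg_iff_add_eq_zero, add_comm]; exact ha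
      rw [h']
      exact r₁.neg_mem (r₁.smul_mem _ h0r1)
    exact (Submodule.smul_mem_iff _ hne).1 this
  rw [a1, zero_smul, add_zero] at ha
  have a0 : a 0 = 0 := by
    rcases smul_eq_zero.1 ha with h | h
    · exact h
    · exact absurd h e0ne
  intro i
  fin_cases i
  · exact a0
  · exact a1
  · exact a2
  · exact a3

lemma bad_chart {F : MvPolynomial (Fin 5) ℂ} {l r₁ r₂ Pl₁ Pl₂ : Submodule ℂ (Fin 5 → ℂ)}
    (hr : r₁ ≠ r₂) (hF2 : LiesOn F r₂) (hc1 : CycleLplus2R F l r₁ Pl₁)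
    (hc2 : CycleLplus2R F l r₂ Pl₂) (hd : Module.finrank ℂ ↥(l ⊓ r₁) = 1)
    (heq : l ⊓ r₁ = l ⊓ r₂) :
    ∃ (q : Fin 5 × (Fin 3 → Fin 4) × Fin 5), ∃ θ,
      ((chartMat q.1 q.2.1 q.2.2).map (eval θ)).det ≠ 0 ∧
      ∀ b, (linSubst ((chartMat q.1 q.2.1 q.2.2).map (eval θ)) F).coeff (badMon b).1 = 0 := by
  obtain ⟨i0, s, e, hli, h0, h1, h2, h3, k1, k2, k3, m0, m0', m0'', m1, m2, m3⟩ :=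
    exists_frame hr hF2 hc1 hc2 hd heq
  obtain ⟨j, hj⟩ := exists_std_completion e hli
  obtain ⟨θ, hθ⟩ := exists_chart_param i0 s j (e 0) (e 1) (e 2) (e 3) h0 h1 h2 h3 k1 k2 k3
  refine ⟨(i0, s, j), θ, ?_, ?_⟩
  · rw [hθ]; exact hj
  · rw [hθ]
    obtain ⟨c1, hc1⟩ := cycle_eval hc1 m0 m0' m1 m2
    obtain ⟨c2, hc2⟩ := cycle_eval hc2 m0 m0'' m1 m3
    refine bad_coeff_zero _ c1 c2 ?_ ?_
    · intro a b c
      rw [eval_linSubst, ← hc1]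
      congr 2
      ext r
      simp [Matrix.mulVec, dotProduct, Fin.sum_univ_five]
      ring
    · intro a b c
      rw [eval_linSubst, ← hc2]
      congr 2
      ext r
      simp [Matrix.mulVec, dotProduct, Fin.sum_univ_five]
      ring

lemma prod_helper {ι : Type} [Finite ι] (Q : ι → MvPolynomial Deg3Monomials ℂ)
    (hQ : ∀ i, Q i ≠ 0) : ∃ P : MvPolynomial Deg3Monomials ℂ, P ≠ 0 ∧
      ∀ x, eval x P ≠ 0 → ∀ i, eval x (Q i) ≠ 0 := by
  let _ : Fintype ι := Fintype.ofFinite ι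
  refine ⟨∏ i, Q i, Finset.prod_ne_zero_iff.2 fun i _ => hQ i, fun x hx i => ?_⟩
  rw [map_prod] at hx
  exact Finset.prod_ne_zero_iff.1 hx i (Finset.mem_univ i)

/-- For a general smooth cubic threefold `V ⊂ ℙ⁴`, there is no line `l` on `V` with
two distinct residual double lines `r₁ ≠ r₂` meeting `l` at the same point, i.e.
with the 1-dimensional subspaces `l ∩ r₁` and `l ∩ r₂` of `ℂ⁵` coinciding. -/
theorem general_cubic_no_line_with_concurrent_residual_double_lines :
    ∃ P : MvPolynomial Deg3Monomials ℂ, P ≠ 0 ∧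
      ∀ F : MvPolynomial (Fin 5) ℂ, F.IsHomogeneous 3 →
        eval (fun d : Deg3Monomials => F.coeff d.1) P ≠ 0 →
        IsSmoothCubic F ∧
        ¬∃ l r₁ r₂ Pl₁ Pl₂ : Submodule ℂ (Fin 5 → ℂ),
          r₁ ≠ r₂ ∧ LiesOn F l ∧ LiesOn F r₁ ∧ LiesOn F r₂ ∧
          CycleLplus2R F l r₁ Pl₁ ∧ CycleLplus2R F l r₂ Pl₂ ∧
          Module.finrank ℂ ↥(l ⊓ r₁) = 1 ∧ l ⊓ r₁ = l ⊓ r₂ := by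
  choose P₁ hP₁ hP₁' using smooth_chart
  choose P₂ hP₂ hP₂' using line_chart
  obtain ⟨Q₁, hQ₁, hQ₁'⟩ := prod_helper P₁ hP₁
  obtain ⟨Q₂, hQ₂, hQ₂'⟩ := prod_helper P₂ hP₂
  refine ⟨Q₁ * Q₂, mul_ne_zero hQ₁ hQ₂, ?_⟩
  intro F hF hne
  rw [map_mul] at hne
  have hne1 := hQ₁' _ (left_ne_zero_of_mul hne)
  have hne2 := hQ₂' _ (right_ne_zero_of_mul hne)
  refine ⟨?_, ?_⟩
  · intro p hp
    by_contra hp0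
    obtain ⟨i0, hi0⟩ := Function.ne_iff.1 hp0
    simp only [Pi.zero_apply] at hi0
    refine hne1 i0 (hP₁' i0 F hF ((p i0)⁻¹ • p) (by simp [hi0]) fun i => ?_)
    rw [eval_smul_of_homogeneous (hF.pderiv (i := i)), hp i, mul_zero]
  · rintro ⟨l, r₁, r₂, Pl₁, Pl₂, hr, -, -, hF2, hc1, hc2, hd, heq⟩
    obtain ⟨q, θ, hdet, hz⟩ := bad_chart hr hF2 hc1 hc2 hd heq
    exact hne2 q (hP₂' q F hF θ hdet hz)

end
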